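/- Let k, h ≥ 1, let u ∈ F_n^k and w ∈ F_n^h be unitaries, and let λ_u, λ_w : A → A be unital *-homomorphisms with λ_u(Sᵢ) = uSᵢ and λ_w(Sᵢ) = wSᵢ for all i, such that λ_u ∘ λ_w = id_A = λ_w ∘ λ_u. Then the coupled matrix equations u_h w u_h* = u* and w_k u w_k* = w* hold. -/

import Mathlib

noncomputable section CuntzSetup

/-- The word `S_μ = S_{μ₁} ⋯ S_{μ_k}` associated to a multi-index `μ ∈ {1,…,n}^k`. -/
def cuntzWord {A : Type*} [Monoid A] {n k : ℕ} (S : Fin n → A) (μ : Fin k → Fin n) : A :=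
  (List.ofFn fun i => S (μ i)).prod

/-- The canonical shift `φ(x) = ∑ᵢ Sᵢ x Sᵢ*`. -/
def cuntzPhi {A : Type*} [Ring A] [StarRing A] {n : ℕ} (S : Fin n → A) (x : A) : A :=
  ∑ i, S i * x * star (S i)

/-- `u_k = u φ(u) φ²(u) ⋯ φ^{k-1}(u)`. -/
def cuntzUk {A : Type*} [Ring A] [StarRing A] {n : ℕ} (S : Fin n → A) (u : A) (k : ℕ) : A :=
  ((List.range k).map fun j => (cuntzPhi S)^[j] u).prod

/-- `F_n^k`, the linear span of `{S_μ S_ν* : |μ| = |ν| = k}`. -/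
def cuntzF {A : Type*} [Ring A] [StarRing A] [Algebra ℂ A] {n : ℕ} (S : Fin n → A) (k : ℕ) :
    Submodule ℂ A :=
  Submodule.span ℂ {x | ∃ μ ν : Fin k → Fin n, x = cuntzWord S μ * star (cuntzWord S ν)}

end CuntzSetup

section CuntzAux

/-- In a C⋆-algebra, isometries whose range projections sum to `1` have orthogonal ranges. -/
lemma star_mul_eq_zero_of_sum_mul_star_eq_one {A : Type*} [NormedRing A] [StarRing A]
    [CStarRing A] [CompleteSpace A] [NormedAlgebra ℂ A] [StarModule ℂ A]
    {n : ℕ} {S : Fin n → A} (hiso : ∀ i, star (S i) * S i = 1)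
    (hcuntz : ∑ i, S i * star (S i) = 1) {i j : Fin n} (hij : i ≠ j) :
    star (S i) * S j = 0 := by
  let _ : CStarAlgebra A := {}
  let _ : PartialOrder A := CStarAlgebra.spectralOrder A
  have : StarOrderedRing A := CStarAlgebra.spectralOrderedRing A
  have hsum : ∑ l, star (S i) * S l * star (star (S i) * S l) = 1 := by
    calc ∑ l, star (S i) * S l * star (star (S i) * S l)
        = star (S i) * (∑ l, S l * star (S l)) * S i := by
          simp [Finset.mul_sum, Finset.sum_mul, mul_assoc]
      _ = 1 := by rw [hcuntz, mul_one, hiso]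
  rw [← Finset.add_sum_erase _ _ (Finset.mem_univ i), hiso, star_one, mul_one,
    add_eq_left, Finset.sum_eq_zero_iff_of_nonneg fun l _ => mul_star_self_nonneg _] at hsum
  exact (CStarRing.mul_star_self_eq_zero_iff _).1
    (hsum j (Finset.mem_erase.2 ⟨hij.symm, Finset.mem_univ j⟩))

variable {A : Type*} [Ring A] [StarRing A] {n : ℕ} {S : Fin n → A}

lemma cuntzPhi_mul_generator (hiso : ∀ i, star (S i) * S i = 1)
    (horth : ∀ i j, i ≠ j → star (S i) * S j = 0) (x : A) (i : Fin n) :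
    cuntzPhi S x * S i = S i * x := by
  rw [cuntzPhi, Finset.sum_mul, Finset.sum_eq_single i]
  · rw [mul_assoc, hiso, mul_one]
  · intro j _ hj
    rw [mul_assoc, horth j i hj, mul_zero]
  · simp

lemma eq_of_forall_mul_generator_eq (hcuntz : ∑ i, S i * star (S i) = 1) {x y : A}
    (hxy : ∀ i, x * S i = y * S i) : x = y := by
  rw [← mul_one x, ← mul_one y, ← hcuntz, Finset.mul_sum, Finset.mul_sum]
  simp only [← mul_assoc, hxy]

lemma cuntzPhi_mul (hiso : ∀ i, star (S i) * S i = 1)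
    (hcuntz : ∑ i, S i * star (S i) = 1) (horth : ∀ i j, i ≠ j → star (S i) * S j = 0)
    (x y : A) : cuntzPhi S (x * y) = cuntzPhi S x * cuntzPhi S y := by
  refine eq_of_forall_mul_generator_eq hcuntz fun i => ?_
  rw [mul_assoc (cuntzPhi S x)]
  simp only [cuntzPhi_mul_generator hiso horth]
  rw [← mul_assoc, ← mul_assoc, cuntzPhi_mul_generator hiso horth]

lemma cuntzPhi_one (hcuntz : ∑ i, S i * star (S i) = 1) : cuntzPhi S 1 = 1 := by
  simpa [cuntzPhi] using hcuntz

lemma cuntzUk_succ (hiso : ∀ i, star (S i) * S i = 1)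
    (hcuntz : ∑ i, S i * star (S i) = 1) (horth : ∀ i j, i ≠ j → star (S i) * S j = 0)
    (u : A) (k : ℕ) : cuntzUk S u (k + 1) = u * cuntzPhi S (cuntzUk S u k) := by
  let Φ : A →* A := ⟨⟨cuntzPhi S, cuntzPhi_one hcuntz⟩, cuntzPhi_mul hiso hcuntz horth⟩
  have hΦ : cuntzPhi S (cuntzUk S u k) =
      ((List.range k).map fun j => (cuntzPhi S)^[j + 1] u).prod := by
    change Φ (cuntzUk S u k) = _
    rw [cuntzUk, map_list_prod, List.map_map]
    simp only [Function.iterate_succ_apply']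
    rfl
  rw [hΦ, cuntzUk, List.range_succ_eq_map, List.map_cons, List.prod_cons, List.map_map]
  rfl

variable [Algebra ℂ A]

lemma map_cuntzWord (hiso : ∀ i, star (S i) * S i = 1)
    (hcuntz : ∑ i, S i * star (S i) = 1) (horth : ∀ i j, i ≠ j → star (S i) * S j = 0)
    {u : A} {f : A →⋆ₐ[ℂ] A} (hf : ∀ i, f (S i) = u * S i) :
    ∀ {k : ℕ} (μ : Fin k → Fin n), f (cuntzWord S μ) = cuntzUk S u k * cuntzWord S μ := by
  intro k
  induction k with
  | zero => intro μ; simp [cuntzWord, cuntzUk]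
  | succ k ih =>
    intro μ
    have hword : cuntzWord S μ = S (μ 0) * cuntzWord S (fun i => μ i.succ) := by
      simp [cuntzWord, List.ofFn_succ]
    rw [hword, map_mul, hf, ih, cuntzUk_succ hiso hcuntz horth, mul_assoc u (cuntzPhi S _),
      ← mul_assoc (cuntzPhi S _), cuntzPhi_mul_generator hiso horth]
    simp only [mul_assoc]

/-- On `F_n^k`, an endomorphism with `S i ↦ u * S i` is given by `x ↦ u_k x u_k*`. -/
lemma map_eq_of_mem_cuntzF (hiso : ∀ i, star (S i) * S i = 1)
    (hcuntz : ∑ i, S i * star (S i) = 1) (horth : ∀ i j, i ≠ j → star (S i) * S j = 0)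
    {u : A} {f : A →⋆ₐ[ℂ] A} (hf : ∀ i, f (S i) = u * S i) {k : ℕ} {x : A}
    (hx : x ∈ cuntzF S k) : f x = cuntzUk S u k * x * star (cuntzUk S u k) := by
  induction hx using Submodule.span_induction with
  | mem x hx =>
    obtain ⟨μ, ν, rfl⟩ := hx
    rw [map_mul, map_star, map_cuntzWord hiso hcuntz horth hf,
      map_cuntzWord hiso hcuntz horth hf, star_mul]
    simp only [mul_assoc]
  | zero => simp
  | add x y _ _ hx hy => rw [map_add, hx, hy, mul_add, add_mul]
  | smul c x _ hx => rw [map_smul, hx, mul_smul_comm, smul_mul_assoc]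

/-- If `f ∘ g = id` with `f (S i) = u * S i` and `g (S i) = w * S i`, then `f w = u*`. -/
lemma map_unitary_eq_star (hcuntz : ∑ i, S i * star (S i) = 1)
    {u w : A} (hu : u ∈ unitary A) {f g : A →⋆ₐ[ℂ] A} (hf : ∀ i, f (S i) = u * S i)
    (hg : ∀ i, g (S i) = w * S i) (hfg : ∀ a, f (g a) = a) : f w = star u := by
  have hinv : f w * u = 1 := by
    refine eq_of_forall_mul_generator_eq hcuntz fun i => ?_
    rw [mul_assoc, ← hf, ← map_mul, ← hg, hfg, one_mul]
  rw [← mul_one (f w), ← Unitary.mul_star_self_of_mem hu, ← mul_assoc, hinv, one_mul]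

end CuntzAux


/-- if unitaries `u ∈ F_n^k`, `w ∈ F_n^h` induce mutually inverse
endomorphisms, then the coupled matrix equations `u_h w u_h* = u*` and
`w_k u w_k* = w*` hold. -/
theorem stmt7 {A : Type*} [NormedRing A] [StarRing A] [CStarRing A]
    [CompleteSpace A] [NormedAlgebra ℂ A] [StarModule ℂ A]
    {n : ℕ} (hn : 2 ≤ n) (S : Fin n → A)
    (hiso : ∀ i, star (S i) * S i = 1)
    (hcuntz : ∑ i, S i * star (S i) = 1)
    (k h : ℕ) (hk : 1 ≤ k) (hh : 1 ≤ h)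
    (u w : A) (huF : u ∈ cuntzF S k) (hwF : w ∈ cuntzF S h)
    (hu : u ∈ unitary A) (hw : w ∈ unitary A)
    (lu lw : A →⋆ₐ[ℂ] A)
    (hlu : ∀ i, lu (S i) = u * S i)
    (hlw : ∀ i, lw (S i) = w * S i)
    (huw : ∀ a : A, lu (lw a) = a) (hwu : ∀ a : A, lw (lu a) = a) :
    cuntzUk S u h * w * star (cuntzUk S u h) = star u ∧
      cuntzUk S w k * u * star (cuntzUk S w k) = star w := by
  have horth : ∀ i j, i ≠ j → star (S i) * S j = 0 := fun _ _ hij =>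
    star_mul_eq_zero_of_sum_mul_star_eq_one hiso hcuntz hij
  rw [← map_eq_of_mem_cuntzF hiso hcuntz horth hlu hwF,
    ← map_eq_of_mem_cuntzF hiso hcuntz horth hlw huF]
  exact ⟨map_unitary_eq_star hcuntz hu hlu hlw huw, map_unitary_eq_star hcuntz hw hlw hlu hwu⟩
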